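/- Assume n ≥ 2, and let i ∈ [n]. Then t_{n−1} · [t_i, t_{n−1}] = 0 in k[S_n]. -/

import Mathlib

/-- The simple transposition `s_i ∈ S_n` (1-based indexing), swapping `i` and `i+1`,
defined as the identity for `i` outside `{1, …, n-1}`. -/
def simpleTransposition (n i : ℕ) : Equiv.Perm (Fin n) :=
  if h : 1 ≤ i ∧ i < n then
    Equiv.swap ⟨i - 1, by omega⟩ ⟨i, h.2⟩
  else 1

/-- The cycle `(v ⟹ w) = s_v s_{v+1} ⋯ s_{w-1} ∈ S_n`, sending
`v ↦ v+1 ↦ ⋯ ↦ w ↦ v` (and equal to the identity when `v = w`). -/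
def cyc (n v w : ℕ) : Equiv.Perm (Fin n) :=
  ((List.range' v (w - v)).map (simpleTransposition n)).prod

/-- The somewhere-to-below shuffle `t_ℓ = Σ_{w=ℓ}^{n} (ℓ ⟹ w)` in the group
algebra `R[S_n]`. -/
noncomputable def t (R : Type*) [CommRing R] (n ℓ : ℕ) :
    MonoidAlgebra R (Equiv.Perm (Fin n)) :=
  ∑ w ∈ Finset.Icc ℓ n, MonoidAlgebra.of R (Equiv.Perm (Fin n)) (cyc n ℓ w)

theorem simpleTransposition_mul_self (n i : ℕ) :
    simpleTransposition n i * simpleTransposition n i = 1 := by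
  unfold simpleTransposition
  split_ifs
  · exact Equiv.swap_mul_self _ _
  · exact one_mul 1

theorem simpleTransposition_commute {n i j : ℕ} (h : i + 1 < j) :
    Commute (simpleTransposition n i) (simpleTransposition n j) := by
  unfold simpleTransposition
  split_ifs
  · refine (Equiv.Perm.disjoint_swap_swap ?_).commute
    simp only [List.nodup_cons, List.mem_cons, List.not_mem_nil, Fin.mk.injEq]
    grind
  all_goals simp

theorem cyc_self (n v : ℕ) : cyc n v v = 1 := by
  simp [cyc]

theorem cyc_succ (n : ℕ) {v w : ℕ} (h : v ≤ w) :
    cyc n v (w + 1) = cyc n v w * simpleTransposition n w := by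
  simp [cyc, Nat.succ_sub h, List.range'_concat, Nat.add_sub_cancel' h]

theorem cyc_commute_simpleTransposition {n v w j : ℕ} (h : w < j) :
    Commute (cyc n v w) (simpleTransposition n j) := by
  refine Commute.list_prod_left _ _ fun x hx => ?_
  obtain ⟨i, hi, rfl⟩ := List.mem_map.1 hx
  rw [List.mem_range'_1] at hi
  exact simpleTransposition_commute (by omega)

theorem t_self (R : Type*) [CommRing R] (n : ℕ) : t R n n = 1 := by
  simp [t, cyc_self, MonoidAlgebra.one_def]

theorem t_pred (R : Type*) [CommRing R] (m : ℕ) :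
    t R (m + 1) m = 1 + MonoidAlgebra.of R _ (simpleTransposition (m + 1) m) := by
  rw [t, Finset.sum_Icc_succ_top (by omega), Finset.Icc_self, Finset.sum_singleton,
    cyc_succ _ le_rfl, cyc_self, one_mul, map_one]

/-- Left multiplication by `1 + s_{n-1}` makes `t_i` invariant under right multiplication
by `s_{n-1}`. -/
theorem one_add_mul_t_mul_simpleTransposition (R : Type*) [CommRing R] {m i : ℕ}
    (hi : i ≤ m + 1) :
    (1 + MonoidAlgebra.of R _ (simpleTransposition (m + 2) (m + 1))) * t R (m + 2) i *
        MonoidAlgebra.of R _ (simpleTransposition (m + 2) (m + 1)) =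
      (1 + MonoidAlgebra.of R _ (simpleTransposition (m + 2) (m + 1))) * t R (m + 2) i := by
  set s := MonoidAlgebra.of R _ (simpleTransposition (m + 2) (m + 1)) with hs
  have hss : s * s = 1 := by
    rw [hs, ← map_mul, simpleTransposition_mul_self, map_one]
  have hcomm : Commute
      (∑ w ∈ Finset.Icc i m, MonoidAlgebra.of R (Equiv.Perm (Fin (m + 2))) (cyc (m + 2) i w)) s :=
    Commute.sum_left _ _ _ fun w hw =>
      (cyc_commute_simpleTransposition (by grind)).map (MonoidAlgebra.of R _)
  rw [t, Finset.sum_Icc_succ_top (by omega), Finset.sum_Icc_succ_top hi, cyc_succ _ hi, map_mul,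
    ← hs]
  generalize (∑ w ∈ Finset.Icc i m, MonoidAlgebra.of R _ (cyc (m + 2) i w)) = a at hcomm ⊢
  generalize MonoidAlgebra.of R _ (cyc (m + 2) i (m + 1)) = c
  have ha : (1 + s) * a * s = (1 + s) * a := by
    rw [mul_assoc, hcomm.eq, ← mul_assoc, add_mul, hss, one_mul, add_comm s]
  have hc : (c + c * s) * s = c + c * s := by
    rw [add_mul, mul_assoc, hss, mul_one, add_comm (c * s)]
  rw [add_assoc, mul_add, add_mul, ha, mul_assoc, hc]

theorem t_nm1_mul_comm_eq_zero
    (R : Type*) [CommRing R] (n : ℕ) (hn : 2 ≤ n)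
    (i : ℕ) (hi1 : 1 ≤ i) (hin : i ≤ n) :
    t R n (n - 1) * (t R n i * t R n (n - 1) - t R n (n - 1) * t R n i) = 0 := by
  obtain ⟨m, rfl⟩ := Nat.exists_eq_add_of_le' hn
  obtain rfl | hi : i = m + 2 ∨ i ≤ m + 1 := by omega
  · simp [t_self]
  have key := one_add_mul_t_mul_simpleTransposition R hi
  rw [show m + 2 - 1 = m + 1 by omega, t_pred]
  set s := MonoidAlgebra.of R _ (simpleTransposition (m + 2) (m + 1)) with hs
  have hss : s * s = 1 := by
    rw [hs, ← map_mul, simpleTransposition_mul_self, map_one]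
  have hsq : (1 + s) * (1 + s) = (1 + s) + (1 + s) := by
    rw [add_mul, one_mul, mul_add, mul_one, hss, add_comm s 1]
  rw [mul_sub, ← mul_assoc, ← mul_assoc, hsq, mul_add, mul_one, key, add_mul (1 + s) (1 + s),
    sub_self]
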